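/- (Upper bounds on flux terms in the derivative of the firewall.) In the setting below, assume additionally that r₀ = r_esc(t₀) and that (c+κ)(c̄ − c) ≤ κ·c_cut/4. Then there exists a positive quantity K(u), depending only on V and on the solution u (but not on the parameters t₀, r₀, c, x_cut), such that for every s ≥ 0: G_back(s) ≤ K(u)·e^{−κ x_cut}·e^{−(κ c_cut/2)s} and G_front(s) ≤ κ⁻¹·e^{(c_noesc+1)x_cut}·e^{(c_noesc+κ)(c_cut+κ)s}·e^{−κ ρ_Hom(0)}. -/

import Mathlib

open Filter Topology Set MeasureTheory

noncomputable section

local notation "⟪" x ", " y "⟫" => @inner ℝ _ _ x y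

abbrev Euc (n : ℕ) : Type := EuclideanSpace ℝ (Fin n)

variable {n : ℕ}

/-- Spatial partial derivative `u_r`. -/
def ur (u : ℝ → ℝ → Euc n) (r t : ℝ) : Euc n := deriv (fun s => u s t) r

/-- Second spatial partial derivative `u_rr`. -/
def urr (u : ℝ → ℝ → Euc n) (r t : ℝ) : Euc n := deriv (fun s => ur u s t) r

/-- Time partial derivative `u_t`. -/
def ut (u : ℝ → ℝ → Euc n) (r t : ℝ) : Euc n := deriv (fun s => u r s) t

/-- Hessian (second differential) of the potential. -/
def hess (V : Euc n → ℝ) (x : Euc n) : Euc n →L[ℝ] Euc n := fderiv ℝ (gradient V) x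

/-- Coercivity hypothesis. -/
def HCoerc (V : Euc n → ℝ) : Prop :=
  ∃ ε > (0:ℝ), ∃ R : ℝ, ∀ x : Euc n, R ≤ ‖x‖ → ε * ‖x‖ ^ 2 ≤ ⟪x, gradient V x⟫

/-- The set of nondegenerate minimum points of `V`. -/
def MinSet (V : Euc n → ℝ) : Set (Euc n) :=
  {m | gradient V m = 0 ∧ ∀ v : Euc n, v ≠ 0 → 0 < ⟪v, hess V m v⟫}

/-- Data of the constants `λ_min`, `λ_max`, `d_Esc` from the paper, together with their
spectral characterizations. -/
structure EscData (n : ℕ) (V : Euc n → ℝ) where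
  lmin : ℝ
  lmax : ℝ
  dEsc : ℝ
  lmin_pos : 0 < lmin
  dEsc_pos : 0 < dEsc
  lower : ∀ m ∈ MinSet V, ∀ v : Euc n, lmin * ‖v‖ ^ 2 ≤ ⟪v, hess V m v⟫
  upper : ∀ m ∈ MinSet V, ∀ v : Euc n, ⟪v, hess V m v⟫ ≤ lmax * ‖v‖ ^ 2
  esc_lower : ∀ m ∈ MinSet V, ∀ x : Euc n, ‖x - m‖ ≤ dEsc →
    ∀ v : Euc n, lmin / 2 * ‖v‖ ^ 2 ≤ ⟪v, hess V x v⟫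
  esc_upper : ∀ m ∈ MinSet V, ∀ x : Euc n, ‖x - m‖ ≤ dEsc →
    ∀ v : Euc n, ⟪v, hess V x v⟫ ≤ 2 * lmax * ‖v‖ ^ 2

/-- Radially symmetric solution of `u_t = -∇V(u) + ((d-1)/r) u_r + u_rr` with Neumann
boundary condition at the origin. -/
structure IsRadialSolution (d : ℕ) (V : Euc n → ℝ) (u : ℝ → ℝ → Euc n) : Prop where
  diff_r : ∀ t > (0:ℝ), ∀ r : ℝ, DifferentiableAt ℝ (fun s => u s t) r
  diff_rr : ∀ t > (0:ℝ), ∀ r : ℝ, DifferentiableAt ℝ (fun s => ur u s t) r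
  cont_rr : ∀ t > (0:ℝ), Continuous fun r => urr u r t
  diff_t : ∀ t > (0:ℝ), ∀ r : ℝ, DifferentiableAt ℝ (fun s => u r s) t
  cont_t : ∀ r : ℝ, ContinuousOn (fun s => ut u r s) (Ioi 0)
  bounded : ∃ C : ℝ, ∀ r t : ℝ, 0 ≤ r → 0 < t →
    ‖u r t‖ + ‖ur u r t‖ + ‖urr u r t‖ + ‖ut u r t‖ ≤ C
  pde : ∀ r > (0:ℝ), ∀ t > (0:ℝ),
    ut u r t = -gradient V (u r t) + (((d : ℝ) - 1) / r) • ur u r t + urr u r t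
  neumann : ∀ t > (0:ℝ), ur u 0 t = 0

/-- Profiles of fronts travelling at speed `c` connecting `um` to `up`
(nonconstant solutions of `φ'' = -cφ' + ∇V(φ)`). -/
def Phi (V : Euc n → ℝ) (c : ℝ) (um up : Euc n) : Set (ℝ → Euc n) :=
  {φ | (∃ ξ₁ ξ₂ : ℝ, φ ξ₁ ≠ φ ξ₂) ∧
    (∀ ξ : ℝ, DifferentiableAt ℝ φ ξ) ∧ (∀ ξ : ℝ, DifferentiableAt ℝ (deriv φ) ξ) ∧
    (∀ ξ : ℝ, deriv (deriv φ) ξ = -(c • deriv φ ξ) + gradient V (φ ξ)) ∧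
    Tendsto φ atBot (𝓝 um) ∧ Tendsto φ atTop (𝓝 up)}

/-- Fronts travelling at speed `c` invading the equilibrium `mp`. -/
def PhiInv (V : Euc n → ℝ) (c : ℝ) (mp : Euc n) : Set (ℝ → Euc n) :=
  ⋃ mm ∈ MinSet V, Phi V c mm mp

/-- Normalized front profiles. -/
def PhiNorm (V : Euc n → ℝ) (dEsc c : ℝ) (mm mp : Euc n) : Set (ℝ → Euc n) :=
  {φ | φ ∈ Phi V c mm mp ∧ ‖φ 0 - mp‖ = dEsc ∧ ∀ ξ > (0:ℝ), ‖φ ξ - mp‖ < dEsc}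

/-- Normalized front profiles invading `mp`. -/
def PhiNormInv (V : Euc n → ℝ) (dEsc c : ℝ) (mp : Euc n) : Set (ℝ → Euc n) :=
  ⋃ mm ∈ MinSet V, PhiNorm V dEsc c mm mp

/-- Every critical point of `V` is nondegenerate. -/
def HNonDeg (V : Euc n → ℝ) : Prop :=
  ∀ x : Euc n, gradient V x = 0 → ∀ v : Euc n, hess V x v = 0 → v = 0

/-- Every front travelling at a positive speed and invading a minimum point is bistable. -/
def HOnlyBist (V : Euc n → ℝ) : Prop :=
  ∀ mp ∈ MinSet V, ∀ um : Euc n, gradient V um = 0 →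
    ∀ c > (0:ℝ), (Phi V c um mp).Nonempty → um ∈ MinSet V

/-- The set of invading speeds has empty interior. -/
def HDiscVel (V : Euc n → ℝ) : Prop :=
  ∀ mp ∈ MinSet V, interior {c : ℝ | 0 ≤ c ∧ (PhiInv V c mp).Nonempty} = ∅

/-- The set of initial values of normalized invading fronts is totally disconnected. -/
def HDiscFront (V : Euc n → ℝ) (dEsc : ℝ) : Prop :=
  ∀ mp ∈ MinSet V, ∀ c > (0:ℝ),
    IsTotallyDisconnected
      {p : Euc n × Euc n | ∃ φ ∈ PhiNormInv V dEsc c mp, p = (φ 0, deriv φ 0)}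

/-- The generic hypotheses on the potential. -/
def HGen (V : Euc n → ℝ) (dEsc : ℝ) : Prop :=
  HNonDeg V ∧ HOnlyBist V ∧ HDiscVel V ∧ HDiscFront V dEsc

/-- The solution is stable at infinity, close to the minimum point `m`. -/
def StableAtInfinity (V : Euc n → ℝ) (u : ℝ → ℝ → Euc n) (m : Euc n) : Prop :=
  m ∈ MinSet V ∧
    Tendsto (fun t => limsup (fun r => ‖u r t - m‖) atTop) atTop (𝓝 0)

/-- Propagating terrace of bistable fronts connecting `mLoc` to `mFar`. -/
def IsTerrace (V : Euc n → ℝ) (mLoc mFar : Euc n) (T : ℝ → ℝ → Euc n) : Prop :=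
  ∃ (q : ℕ) (ms : ℕ → Euc n) (cs : ℕ → ℝ) (φs : ℕ → ℝ → Euc n) (rs : ℕ → ℝ → ℝ),
    ms 0 = mFar ∧ ms q = mLoc ∧ (∀ i, i ≤ q → ms i ∈ MinSet V) ∧
    (∀ i, i < q → V (ms (i + 1)) < V (ms i)) ∧
    (∀ i, 1 ≤ i → i ≤ q → 0 < cs i) ∧
    (∀ i, 1 ≤ i → i + 1 ≤ q → cs (i + 1) ≤ cs i) ∧
    (∀ i, 1 ≤ i → i ≤ q → φs i ∈ Phi V (cs i) (ms i) (ms (i - 1))) ∧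
    (∀ i, 1 ≤ i → i ≤ q →
      (∀ t : ℝ, 0 ≤ t → 0 ≤ rs i t) ∧ (∀ t : ℝ, DifferentiableAt ℝ (rs i) t) ∧
        Tendsto (deriv (rs i)) atTop (𝓝 (cs i))) ∧
    (∀ i, 1 ≤ i → i + 1 ≤ q → Tendsto (fun t => rs (i + 1) t - rs i t) atTop atTop) ∧
    (∀ r t : ℝ, 0 ≤ r → 0 ≤ t →
      T r t = ms 0 + ∑ i ∈ Finset.Icc 1 q, (φs i (r - rs i t) - ms (i - 1)))

/-- Hypothesis `(H_hom)` unbundled: `u` is close to `m` on a growing interval around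
`rHom t`, travelling at asymptotic speed `cHom`; closeness is measured in `H¹` norm. -/
def HHomWith (u : ℝ → ℝ → Euc n) (m : Euc n) (cHom : ℝ) (rHom : ℝ → ℝ) : Prop :=
  0 < cHom ∧ (∀ t : ℝ, DifferentiableAt ℝ rHom t) ∧
    Tendsto (deriv rHom) atTop (𝓝 cHom) ∧
    ∀ L > (0:ℝ),
      Tendsto
        (fun t => ∫ r in (-L)..L,
          (‖u (rHom t + r) t - m‖ ^ 2 + ‖ur u (rHom t + r) t‖ ^ 2))
        atTop (𝓝 0)

/-- The set whose supremum defines the Escape point `r_Esc(t)`. -/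
def rEscSet (u : ℝ → ℝ → Euc n) (m : Euc n) (dEsc : ℝ) (rHom : ℝ → ℝ) (t : ℝ) : Set ℝ :=
  {r | r ∈ Icc 0 (rHom t) ∧ ‖u r t - m‖ = dEsc}

/-- The Escape point `r_Esc(t)`. -/
def rEscF (u : ℝ → ℝ → Euc n) (m : Euc n) (dEsc : ℝ) (rHom : ℝ → ℝ) (t : ℝ) : ℝ :=
  sSup (rEscSet u m dEsc rHom t)

/-- The upper limit mean speed `c_Esc` of the Escape point. -/
def cEscV (u : ℝ → ℝ → Euc n) (m : Euc n) (dEsc : ℝ) (rHom : ℝ → ℝ) : ℝ :=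
  limsup (fun t => rEscF u m dEsc rHom t / t) atTop

/-- `q_hull`: minimal convexity of the lower quadratic hulls of `V` at minimum points. -/
def qHull (V : Euc n → ℝ) : ℝ :=
  sInf {q : ℝ | ∃ m ∈ MinSet V, ∃ x : Euc n, x ≠ m ∧ q = (V x - V m) / ‖x - m‖ ^ 2}

/-- The weight `w` of the energy in the firewall functionals. -/
def wV (V : Euc n → ℝ) : ℝ := 1 / max 1 (-(4 * qHull V))

/-- The decay rate `κ₀`. -/
def kappa0 (lmin : ℝ) : ℝ := min (1 / 2) (lmin / 8)

/-- The "small curvature" radius `r_sc`. -/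
def rsc (d : ℕ) (lmin : ℝ) : ℝ := max (2 * ((d : ℝ) - 1)) (8 * ((d : ℝ) - 1) / lmin)

/-- The weight function `T_ρ ψ₀`. -/
def Tpsi (d : ℕ) (lmin : ℝ) (ρ r : ℝ) : ℝ :=
  if r ≤ rsc d lmin then Real.exp (-(kappa0 lmin) * |r - ρ|) * (r / rsc d lmin) ^ (d - 1)
  else Real.exp (-(kappa0 lmin) * |r - ρ|)

/-- The firewall functional `F₀` in the laboratory frame. -/
def F0 (V : Euc n → ℝ) (d : ℕ) (lmin : ℝ) (u : ℝ → ℝ → Euc n) (ρ t : ℝ) : ℝ :=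
  ∫ r in Ioi (0:ℝ),
    Tpsi d lmin ρ r * (wV V * (‖ur u r t‖ ^ 2 / 2 + V (u r t)) + ‖u r t‖ ^ 2 / 2)

/-- The set `Σ₀(t)` where the solution Escapes at distance `dEsc` from the origin. -/
def Sigma0 (u : ℝ → ℝ → Euc n) (dEsc t : ℝ) : Set ℝ := {r | 0 ≤ r ∧ dEsc < ‖u r t‖}

/-- The firewall differential inequality in the laboratory frame. -/
def FireIneq (V : Euc n → ℝ) (d : ℕ) (lmin dEsc : ℝ) (u : ℝ → ℝ → Euc n) (ν K : ℝ) : Prop :=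
  ∀ ρ ≥ rsc d lmin, ∀ t > (0:ℝ),
    DifferentiableAt ℝ (fun s => F0 V d lmin u ρ s) t ∧
    deriv (fun s => F0 V d lmin u ρ s) t ≤
      -ν * F0 V d lmin u ρ t + K * ∫ r in Sigma0 u dEsc t, Tpsi d lmin ρ r

/-- The quantity `δ = d_Esc √(min(w/2,1/4)/(κ₀+1))`. -/
def deltaEsc (dEsc w κ₀ : ℝ) : ℝ := dEsc * Real.sqrt (min (w / 2) (1 / 4) / (κ₀ + 1))

/-- The length `L₀`. -/
def L0c (κ₀ ν K δ : ℝ) : ℝ := κ₀⁻¹ * Real.log (16 * K / (ν * δ ^ 2 * κ₀))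

/-- The no-escape speed `c_noesc`. -/
def cNoEsc (κ₀ K L₀ δ : ℝ) : ℝ := 8 * K * L₀ / (κ₀ * δ ^ 2)

/-- The no-escape hull `h`. -/
def hull (δ L₀ : ℝ) (x : ℝ) : EReal :=
  if x < 0 then ⊤
  else if x ≤ L₀ then ((δ ^ 2 / 2 * (1 - x / (2 * L₀)) : ℝ) : EReal)
  else ((δ ^ 2 / 4 : ℝ) : EReal)

/-- The standing hypothesis that the firewall is below the two mirror hulls positioned
around `rHom t`. -/
def HullBound (V : Euc n → ℝ) (d : ℕ) (lmin : ℝ) (u : ℝ → ℝ → Euc n) (δ L₀ : ℝ)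
    (rHom : ℝ → ℝ) : Prop :=
  ∀ t ≥ (0:ℝ), rsc d lmin ≤ rHom t - 1 ∧
    ∀ r ≥ rsc d lmin, ((F0 V d lmin u r t : ℝ) : EReal) ≤
      max (hull δ L₀ (r - (rHom t - 1))) (hull δ L₀ (rHom t - r))

/-- The set whose infimum defines the escape point `r_esc(t)`. -/
def rescSet (V : Euc n → ℝ) (d : ℕ) (lmin : ℝ) (u : ℝ → ℝ → Euc n) (δ L₀ : ℝ)
    (rHom : ℝ → ℝ) (t : ℝ) : Set ℝ :=
  {rl | rl ∈ Icc (rsc d lmin) (rHom t) ∧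
    ∀ r ≥ rsc d lmin, ((F0 V d lmin u r t : ℝ) : EReal) ≤
      max (hull δ L₀ (r - rl)) (hull δ L₀ (rHom t - r))}

/-- The escape point `r_esc(t)`. -/
def rescF (V : Euc n → ℝ) (d : ℕ) (lmin : ℝ) (u : ℝ → ℝ → Euc n) (δ L₀ : ℝ)
    (rHom : ℝ → ℝ) (t : ℝ) : ℝ :=
  sInf (rescSet V d lmin u δ L₀ rHom t)

/-- `c̄`: upper limit of mean variations of a function over time intervals of length `s`. -/
def cbarF (f : ℝ → ℝ) : ℝ :=
  limsup (fun s => sSup {x : ℝ | ∃ t ≥ (0:ℝ), x = f (t + s) - f t} / s) atTop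

/-- `c̲`: lower limit of mean variations of a function over time intervals of length `s`. -/
def cunderF (f : ℝ → ℝ) : ℝ :=
  liminf (fun s => sInf {x : ℝ | ∃ t ≥ (0:ℝ), x = f (t + s) - f t} / s) atTop

/-- The decay rate `κ` in the travelling frame. -/
def kappaTF (lmin cno : ℝ) : ℝ := min (1 / 4) (lmin / (16 * (cno + 1)))

/-- The cut-off speed `c_cut` in the travelling frame. -/
def ccutTF (lmin lmax cno : ℝ) : ℝ := min (lmin / (8 * lmax)) (lmin / (8 * (cno + 1)))

/-- The energy weight `w'` in the travelling frame. -/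
def wTF (V : Euc n → ℝ) (cno : ℝ) : ℝ := min (wV V) (1 / (cno + 1) ^ 2)

/-- The weight function `χ` of the localized energy in the travelling frame. -/
def chiTF (d : ℕ) (lmin lmax cno c xcut r0 : ℝ) (ρ s : ℝ) : ℝ :=
  if ρ ≤ -r0 - c * s + rsc d lmin then
    Real.exp (c * ρ) * ((r0 + c * s + ρ) / rsc d lmin) ^ (d - 1)
  else if ρ ≤ xcut + ccutTF lmin lmax cno * s then Real.exp (c * ρ)
  else
    Real.exp ((c + kappaTF lmin cno) * (xcut + ccutTF lmin lmax cno * s) -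
      kappaTF lmin cno * ρ)

/-- The weight function `ψ` of the firewall in the travelling frame. -/
def psiTF (d : ℕ) (lmin lmax cno c xcut r0 : ℝ) (ρ s : ℝ) : ℝ :=
  if ρ ≤ -r0 - c * s + rsc d lmin then
    Real.exp ((c + kappaTF lmin cno) * ρ -
        kappaTF lmin cno * (xcut + ccutTF lmin lmax cno * s)) *
      ((r0 + c * s + ρ) / rsc d lmin) ^ (d - 1)
  else if ρ ≤ xcut + ccutTF lmin lmax cno * s then
    Real.exp ((c + kappaTF lmin cno) * ρ -
      kappaTF lmin cno * (xcut + ccutTF lmin lmax cno * s))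
  else
    Real.exp ((c + kappaTF lmin cno) * (xcut + ccutTF lmin lmax cno * s) -
      kappaTF lmin cno * ρ)

/-- The firewall functional `F(s)` in the travelling frame. -/
def FTF (V : Euc n → ℝ) (d : ℕ) (lmin lmax cno : ℝ) (u : ℝ → ℝ → Euc n)
    (t0 c xcut r0 : ℝ) (s : ℝ) : ℝ :=
  ∫ ρ in Ioi (-r0 - c * s),
    psiTF d lmin lmax cno c xcut r0 ρ s *
      (wTF V cno *
          (‖ur u (r0 + c * s + ρ) (t0 + s)‖ ^ 2 / 2 + V (u (r0 + c * s + ρ) (t0 + s))) +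
        ‖u (r0 + c * s + ρ) (t0 + s)‖ ^ 2 / 2)

/-- The set `Σ(s)` where the solution Escapes, in the travelling frame. -/
def SigmaTF (u : ℝ → ℝ → Euc n) (d : ℕ) (lmin dEsc : ℝ) (t0 c r0 : ℝ) (s : ℝ) : Set ℝ :=
  {ρ | -r0 - c * s + rsc d lmin ≤ ρ ∧ dEsc < ‖u (r0 + c * s + ρ) (t0 + s)‖}

/-- The weight function `ψ̃` in the standing frame. -/
def psiSF (d : ℕ) (κ cm cp : ℝ) (r t : ℝ) : ℝ :=
  if r ≤ cm * t then r ^ (d - 1) * Real.exp (-κ * (cm * t - r))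
  else if r ≤ cp * t then r ^ (d - 1)
  else r ^ (d - 1) * Real.exp (-κ * (r - cp * t))

/-- The firewall functional `F̃` in the standing frame. -/
def FSF (V : Euc n → ℝ) (d : ℕ) (κ cm cp : ℝ) (u : ℝ → ℝ → Euc n) (t : ℝ) : ℝ :=
  ∫ r in Ioi (0:ℝ),
    psiSF d κ cm cp r t * (wV V * (‖ur u r t‖ ^ 2 / 2 + V (u r t)) + ‖u r t‖ ^ 2 / 2)

/-- The quantity `δ_dissip(t)` measuring the dissipation around the escape point. -/
def deltaDissip (u : ℝ → ℝ → Euc n) (re : ℝ → ℝ) (cesc : ℝ) (t : ℝ) : ℝ :=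
  sInf {ε : ℝ | 0 < ε ∧
    (∫ τ in (-1:ℝ)..1, ∫ ρ in (-(1/ε))..(1/ε),
      ‖ut u (re (t + τ) + ρ) (t + τ) + cesc • ur u (re (t + τ) + ρ) (t + τ)‖ ^ 2) ≤ ε}

/-- `u` solves the radially symmetric system with initial datum `u₀`, in the sense of the
semi-flow on bounded continuous functions (classical for positive times). -/
def SolvesWithInit (d : ℕ) (V : Euc n → ℝ) (u : ℝ → ℝ → Euc n) (u₀ : ℝ → Euc n) : Prop :=
  (∀ r : ℝ, 0 ≤ r → u r 0 = u₀ r) ∧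
  (∀ t : ℝ, 0 ≤ t → ContinuousOn (fun r => u r t) (Ici 0) ∧ ∃ C, ∀ r : ℝ, 0 ≤ r → ‖u r t‖ ≤ C) ∧
  (∀ t : ℝ, 0 ≤ t → ∀ ε > (0:ℝ), ∃ δ > (0:ℝ), ∀ t' : ℝ, 0 ≤ t' → |t' - t| ≤ δ →
    ∀ r : ℝ, 0 ≤ r → ‖u r t' - u r t‖ ≤ ε) ∧
  (∀ t > (0:ℝ), ∀ r > (0:ℝ),
    DifferentiableAt ℝ (fun s => u s t) r ∧ DifferentiableAt ℝ (fun s => ur u s t) r) ∧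
  (∀ t > (0:ℝ), ∀ r : ℝ, 0 ≤ r → DifferentiableAt ℝ (fun s => u r s) t) ∧
  (∀ t > (0:ℝ), ∀ r > (0:ℝ),
    ut u r t = -gradient V (u r t) + (((d : ℝ) - 1) / r) • ur u r t + urr u r t) ∧
  (∀ t > (0:ℝ), DifferentiableAt ℝ (fun s => u s t) 0 ∧ ur u 0 t = 0)

lemma setIntegral_exp_neg_abs_Iic {κ a r : ℝ} (hκ : 0 < κ) (har : a ≤ r) :
    IntegrableOn (fun x => Real.exp (-κ * |x - r|)) (Iic a) ∧
      ∫ x in Iic a, Real.exp (-κ * |x - r|) = κ⁻¹ * Real.exp (-κ * (r - a)) := by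
  have key : EqOn (fun x => Real.exp (-κ * |x - r|))
      (fun x => Real.exp (-κ * r) * Real.exp (κ * x)) (Iic a) := by
    intro x hx
    have hx' : x - r ≤ 0 := by linarith [mem_Iic.1 hx]
    simp only [abs_of_nonpos hx', ← Real.exp_add]
    congr 1; ring
  constructor
  · rw [integrableOn_congr_fun key measurableSet_Iic]
    exact (integrableOn_exp_mul_Iic hκ a).const_mul _
  · rw [setIntegral_congr_fun measurableSet_Iic key, integral_const_mul, integral_exp_mul_Iic hκ,
      mul_div_assoc', ← Real.exp_add, div_eq_inv_mul]
    congr 2; ring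

lemma setIntegral_exp_neg_abs_Ioi {κ b r : ℝ} (hκ : 0 < κ) (hrb : r ≤ b) :
    IntegrableOn (fun x => Real.exp (-κ * |x - r|)) (Ioi b) ∧
      ∫ x in Ioi b, Real.exp (-κ * |x - r|) = κ⁻¹ * Real.exp (-κ * (b - r)) := by
  have key : EqOn (fun x => Real.exp (-κ * |x - r|))
      (fun x => Real.exp (κ * r) * Real.exp (-κ * x)) (Ioi b) := by
    intro x hx
    have hx' : 0 ≤ x - r := by linarith [mem_Ioi.1 hx]
    simp only [abs_of_nonneg hx', ← Real.exp_add]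
    congr 1; ring
  have hκ' : -κ < 0 := by linarith
  constructor
  · rw [integrableOn_congr_fun key measurableSet_Ioi]
    exact (integrableOn_exp_mul_Ioi hκ' b).const_mul _
  · rw [setIntegral_congr_fun measurableSet_Ioi key, integral_const_mul, integral_exp_mul_Ioi hκ',
      neg_div_neg_eq, mul_div_assoc', ← Real.exp_add, div_eq_inv_mul]
    congr 2; ring

lemma integral_exp_neg_abs {κ : ℝ} (hκ : 0 < κ) (r : ℝ) :
    Integrable (fun x => Real.exp (-κ * |x - r|)) ∧
      ∫ x, Real.exp (-κ * |x - r|) = 2 * κ⁻¹ := by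
  obtain ⟨h1, h1'⟩ := setIntegral_exp_neg_abs_Iic hκ (le_refl r)
  obtain ⟨h2, h2'⟩ := setIntegral_exp_neg_abs_Ioi hκ (le_refl r)
  constructor
  · rw [← integrableOn_univ, ← Iic_union_Ioi (a := r)]
    exact h1.union h2
  · rw [← intervalIntegral.integral_Iic_add_Ioi h1 h2, h1', h2']
    simp; ring

lemma kappa0_pos {l : ℝ} (hl : 0 < l) : 0 < kappa0 l := by
  unfold kappa0; positivity

lemma rsc_pos {d : ℕ} (hd : 2 ≤ d) (l : ℝ) : 0 < rsc d l := by
  have : (2 : ℝ) ≤ d := by exact_mod_cast hd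
  exact lt_max_of_lt_left (by linarith)

lemma Tpsi_nonneg {d : ℕ} (hd : 2 ≤ d) (l ρ : ℝ) {r : ℝ} (hr : 0 ≤ r) : 0 ≤ Tpsi d l ρ r := by
  have := rsc_pos hd l
  unfold Tpsi; split_ifs <;> positivity

lemma Tpsi_le {d : ℕ} (hd : 2 ≤ d) (l ρ : ℝ) {r : ℝ} (hr : 0 ≤ r) :
    Tpsi d l ρ r ≤ Real.exp (-(kappa0 l) * |r - ρ|) := by
  have h0 := rsc_pos hd l
  unfold Tpsi; split_ifs with h
  · exact mul_le_of_le_one_right (Real.exp_pos _).le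
      (pow_le_one₀ (by positivity) ((div_le_one h0).2 h))
  · exact le_rfl

lemma Tpsi_of_lt {d : ℕ} {l : ℝ} (ρ : ℝ) {r : ℝ} (hr : rsc d l < r) :
    Tpsi d l ρ r = Real.exp (-(kappa0 l) * |r - ρ|) := by
  unfold Tpsi; rw [if_neg (not_le.2 hr)]

lemma measurable_Tpsi (d : ℕ) (l ρ : ℝ) : Measurable (Tpsi d l ρ) := by
  unfold Tpsi
  refine Measurable.ite measurableSet_Iic ?_ ?_ <;> fun_prop

lemma exists_quadratic_bound {V : Euc n → ℝ} (hV : ContDiff ℝ 2 V) (C : ℝ) :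
    ∃ B : ℝ, 0 ≤ B ∧ ∀ m x : Euc n, ‖m‖ ≤ C → ‖x‖ ≤ C → gradient V m = 0 →
      |V x - V m| ≤ B * ‖x - m‖ ^ 2 := by
  have h1 : ContDiff ℝ 1 (fderiv ℝ V) := hV.fderiv_right (by norm_num)
  obtain ⟨B, hB⟩ := (h1.contDiffOn (s := Metric.closedBall 0 C)).exists_lipschitzOnWith
    one_ne_zero (convex_closedBall 0 C) (isCompact_closedBall 0 C)
  refine ⟨B, B.2, fun m x hm hx hgrad => ?_⟩
  have hfd : fderiv ℝ V m = 0 := by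
    ext y; rw [← inner_gradient_left, hgrad]; simp
  have hm' : m ∈ Metric.closedBall (0 : Euc n) C := by simpa using hm
  have hx' : x ∈ Metric.closedBall (0 : Euc n) C := by simpa using hx
  have hseg := (convex_closedBall (0 : Euc n) C).segment_subset hm' hx'
  have := Convex.norm_image_sub_le_of_norm_fderiv_le (𝕜 := ℝ) (f := V) (C := B * ‖x - m‖)
    (s := segment ℝ m x) (x := m) (y := x)
    (fun y _ => (hV.differentiable (by norm_num)) y) (fun y hy => ?_) (convex_segment m x)
    (left_mem_segment ℝ m x) (right_mem_segment ℝ m x)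
  · rw [Real.norm_eq_abs] at this
    linarith [this]
  · have h := hB.dist_le_mul y (hseg hy) m hm'
    rw [dist_eq_norm, dist_eq_norm, hfd, sub_zero] at h
    refine h.trans (mul_le_mul_of_nonneg_left ?_ B.2)
    obtain ⟨θ, hθ, rfl⟩ := (segment_eq_image' ℝ m x ▸ hy :)
    simp only [add_sub_cancel_left, norm_smul, Real.norm_eq_abs, abs_of_nonneg hθ.1]
    exact mul_le_of_le_one_left (norm_nonneg _) hθ.2

lemma HCoerc.exists_lower_bound {V : Euc n → ℝ} (hV : ContDiff ℝ 2 V) (hc : HCoerc V) :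
    ∃ A : ℝ, ∀ x, A ≤ V x := by
  obtain ⟨ε, hε, R, hR⟩ := hc
  have hcomp := isCompact_closedBall (0 : Euc n) (max R 1)
  obtain ⟨A, hA⟩ := hcomp.bddBelow_image hV.continuous.continuousOn
  have hA' : ∀ x : Euc n, ‖x‖ ≤ max R 1 → A ≤ V x := fun x hx =>
    hA ⟨x, by simpa using hx, rfl⟩
  refine ⟨A, fun x => ?_⟩
  rcases le_or_gt ‖x‖ (max R 1) with hx | hx
  · exact hA' x hx
  have hpos : 0 < max R 1 := lt_max_of_lt_right one_pos
  have hxpos : 0 < ‖x‖ := hpos.trans hx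
  set a := max R 1 / ‖x‖ with ha
  have ha0 : 0 < a := by positivity
  have ha1 : a ≤ 1 := (div_le_one hxpos).2 hx.le
  have hder : ∀ s : ℝ, HasDerivAt (fun s : ℝ => V (s • x)) (fderiv ℝ V (s • x) x) s := by
    intro s
    have h1 := ((hV.differentiable (by norm_num)) (s • x)).hasFDerivAt
    have h2 : HasDerivAt (fun s : ℝ => s • x) x s := by
      simpa using (hasDerivAt_id s).smul_const x
    exact h1.comp_hasDerivAt s h2
  have hmono : MonotoneOn (fun s : ℝ => V (s • x)) (Icc a 1) := by
    refine monotoneOn_of_deriv_nonneg (convex_Icc a 1)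
      (fun s _ => (hder s).continuousAt.continuousWithinAt)
      (fun s _ => (hder s).differentiableAt.differentiableWithinAt) (fun s hs => ?_)
    rw [interior_Icc] at hs
    have hs0 : 0 < s := ha0.trans hs.1
    rw [(hder s).deriv, ← inner_gradient_left]
    have hnorm : R ≤ ‖s • x‖ := by
      rw [norm_smul, Real.norm_eq_abs, abs_of_pos hs0]
      have : a * ‖x‖ = max R 1 := by rw [ha]; field_simp
      calc R ≤ max R 1 := le_max_left _ _
        _ = a * ‖x‖ := this.symm
        _ ≤ s * ‖x‖ := by gcongr; exact hs.1.le
    have h := hR _ hnorm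
    rw [real_inner_smul_left, real_inner_comm] at h
    have : 0 ≤ s * inner ℝ (gradient V (s • x)) x := le_trans (by positivity) h
    exact nonneg_of_mul_nonneg_right this hs0
  have h1 := hmono (left_mem_Icc.2 ha1) (right_mem_Icc.2 ha1) ha1
  simp only [one_smul] at h1
  refine le_trans (hA' _ ?_) h1
  rw [norm_smul, Real.norm_eq_abs, abs_of_pos ha0, ha]
  field_simp; exact le_rfl

lemma wV_pos (V : Euc n → ℝ) : 0 < wV V := by
  unfold wV; positivity

lemma wV_mul_ge {V : Euc n → ℝ} (hV : ContDiff ℝ 2 V) (hc : HCoerc V)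
    (h0 : (0 : Euc n) ∈ MinSet V) (hV0 : V 0 = 0) (x : Euc n) :
    -(‖x‖ ^ 2 / 4) ≤ wV V * V x := by
  obtain ⟨A, hA⟩ := hc.exists_lower_bound hV
  obtain ⟨ε, hε, R, hR⟩ := hc
  have hminset : ∀ m ∈ MinSet V, ‖m‖ ≤ |R| := by
    intro m hm
    by_contra! h
    have h1 := hR m ((le_abs_self R).trans h.le)
    rw [hm.1, inner_zero_right] at h1
    have : 0 < ‖m‖ := (abs_nonneg R).trans_lt h
    have : 0 < ε * ‖m‖ ^ 2 := by positivity
    linarith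
  obtain ⟨M, hM⟩ := (isCompact_closedBall (0 : Euc n) |R|).bddAbove_image
    hV.continuous.continuousOn
  obtain ⟨B, hB, hquad⟩ := exists_quadratic_bound hV (|R| + 1)
  have hbdd : BddBelow {q : ℝ | ∃ m ∈ MinSet V, ∃ x : Euc n, x ≠ m ∧
      q = (V x - V m) / ‖x - m‖ ^ 2} := by
    refine ⟨-(B + |M - A|), ?_⟩
    rintro q ⟨m, hm, y, hy, rfl⟩
    have hpos : 0 < ‖y - m‖ := norm_pos_iff.2 (sub_ne_zero.2 hy)
    rw [le_div_iff₀ (by positivity)]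
    have hmR := hminset m hm
    rcases le_or_gt ‖y - m‖ 1 with h | h
    · have hyR : ‖y‖ ≤ |R| + 1 := by
        have := norm_add_le (y - m) m
        rw [sub_add_cancel] at this; linarith
      have h1 := hquad m y (by linarith) hyR hm.1
      have h2 := neg_abs_le (V y - V m)
      have h3 : 0 ≤ |M - A| * ‖y - m‖ ^ 2 := by positivity
      linarith
    · have h1 : V m ≤ M := hM ⟨m, by simpa using hmR, rfl⟩
      have h2 := hA y
      have h3 := le_abs_self (M - A)
      have h4 : 1 ≤ ‖y - m‖ ^ 2 := one_le_pow₀ h.le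
      have h5 : |M - A| * 1 ≤ |M - A| * ‖y - m‖ ^ 2 := by gcongr
      have h6 : 0 ≤ B * ‖y - m‖ ^ 2 := by positivity
      linarith
  rcases eq_or_ne x 0 with rfl | hx
  · simp [hV0]
  have hq : qHull V ≤ (V x - V 0) / ‖x - 0‖ ^ 2 := csInf_le hbdd ⟨0, h0, x, hx, rfl⟩
  have hpos : 0 < ‖x‖ := norm_pos_iff.2 hx
  rw [hV0, sub_zero, sub_zero, le_div_iff₀ (by positivity)] at hq
  have hw := wV_pos V
  have hwq : -(1 / 4) ≤ wV V * qHull V := by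
    unfold wV
    have hm : 0 < max 1 (-(4 * qHull V)) := by positivity
    rw [one_div_mul_eq_div, le_div_iff₀ hm]
    linarith [le_max_right 1 (-(4 * qHull V))]
  calc -(‖x‖ ^ 2 / 4) = -(1 / 4) * ‖x‖ ^ 2 := by ring
    _ ≤ wV V * qHull V * ‖x‖ ^ 2 := by gcongr
    _ = wV V * (qHull V * ‖x‖ ^ 2) := by ring
    _ ≤ wV V * V x := by gcongr

/-- The unweighted integrand of the firewall functional `F0`. -/
def fireDensity (V : Euc n → ℝ) (u : ℝ → ℝ → Euc n) (r t : ℝ) : ℝ :=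
  wV V * (‖ur u r t‖ ^ 2 / 2 + V (u r t)) + ‖u r t‖ ^ 2 / 2

lemma F0_eq (V : Euc n → ℝ) (d : ℕ) (l : ℝ) (u : ℝ → ℝ → Euc n) (ρ t : ℝ) :
    F0 V d l u ρ t = ∫ r in Ioi (0 : ℝ), Tpsi d l ρ r * fireDensity V u r t := rfl

lemma fireDensity_ge {V : Euc n → ℝ} (hV : ContDiff ℝ 2 V) (hc : HCoerc V)
    (h0 : (0 : Euc n) ∈ MinSet V) (hV0 : V 0 = 0) (u : ℝ → ℝ → Euc n) (r t : ℝ) :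
    min (wV V / 2) (1 / 4) * (‖u r t‖ ^ 2 + ‖ur u r t‖ ^ 2) ≤ fireDensity V u r t := by
  have h1 := wV_mul_ge hV hc h0 hV0 (u r t)
  have h2 : min (wV V / 2) (1 / 4) * ‖u r t‖ ^ 2 ≤ 1 / 4 * ‖u r t‖ ^ 2 := by
    gcongr; exact min_le_right _ _
  have h3 : min (wV V / 2) (1 / 4) * ‖ur u r t‖ ^ 2 ≤ wV V / 2 * ‖ur u r t‖ ^ 2 := by
    gcongr; exact min_le_left _ _
  unfold fireDensity
  linarith

lemma fireDensity_nonneg {V : Euc n → ℝ} (hV : ContDiff ℝ 2 V) (hc : HCoerc V)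
    (h0 : (0 : Euc n) ∈ MinSet V) (hV0 : V 0 = 0) (u : ℝ → ℝ → Euc n) (r t : ℝ) :
    0 ≤ fireDensity V u r t := by
  have := wV_pos V
  exact le_trans (by positivity) (fireDensity_ge hV hc h0 hV0 u r t)

lemma IsRadialSolution.continuous_u {d : ℕ} {V : Euc n → ℝ} {u : ℝ → ℝ → Euc n}
    (hu : IsRadialSolution d V u) {t : ℝ} (ht : 0 < t) : Continuous fun r => u r t :=
  continuous_iff_continuousAt.2 fun r => (hu.diff_r t ht r).continuousAt

lemma IsRadialSolution.continuous_ur {d : ℕ} {V : Euc n → ℝ} {u : ℝ → ℝ → Euc n}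
    (hu : IsRadialSolution d V u) {t : ℝ} (ht : 0 < t) : Continuous fun r => ur u r t :=
  continuous_iff_continuousAt.2 fun r => (hu.diff_rr t ht r).continuousAt

lemma IsRadialSolution.continuous_fireDensity {d : ℕ} {V : Euc n → ℝ} (hV : ContDiff ℝ 2 V)
    {u : ℝ → ℝ → Euc n} (hu : IsRadialSolution d V u) {t : ℝ} (ht : 0 < t) :
    Continuous fun r => fireDensity V u r t := by
  have h1 := hu.continuous_u ht
  have h2 := hu.continuous_ur ht
  have h3 : Continuous fun r => V (u r t) := hV.continuous.comp h1
  unfold fireDensity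
  fun_prop

lemma IsRadialSolution.exists_bound {d : ℕ} {V : Euc n → ℝ} {u : ℝ → ℝ → Euc n}
    (hu : IsRadialSolution d V u) :
    ∃ C : ℝ, 0 ≤ C ∧ ∀ r t : ℝ, 0 ≤ r → 0 < t → ‖u r t‖ ≤ C ∧ ‖ur u r t‖ ≤ C := by
  obtain ⟨C, hC⟩ := hu.bounded
  refine ⟨C, ?_, fun r t hr ht => ?_⟩
  · exact le_trans (by positivity) (hC 0 1 le_rfl one_pos)
  · have := hC r t hr ht
    have h1 := norm_nonneg (u r t)
    have h2 := norm_nonneg (ur u r t)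
    have h3 := norm_nonneg (urr u r t)
    have h4 := norm_nonneg (ut u r t)
    constructor <;> linarith

lemma IsRadialSolution.exists_fireDensity_le {d : ℕ} {V : Euc n → ℝ} (hV : ContDiff ℝ 2 V)
    (h0 : (0 : Euc n) ∈ MinSet V) (hV0 : V 0 = 0)
    {u : ℝ → ℝ → Euc n} (hu : IsRadialSolution d V u) :
    ∃ B M : ℝ, 0 ≤ B ∧ 0 ≤ M ∧ ∀ r t : ℝ, 0 ≤ r → 0 < t →
      fireDensity V u r t ≤ B * (‖u r t‖ ^ 2 + ‖ur u r t‖ ^ 2) ∧ fireDensity V u r t ≤ M := by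
  obtain ⟨C, hC0, hC⟩ := hu.exists_bound
  obtain ⟨B, hB, hquad⟩ := exists_quadratic_bound hV C
  have hw := wV_pos V
  refine ⟨wV V + wV V * B + 1, (wV V + wV V * B + 1) * (C ^ 2 + C ^ 2), by positivity,
    by positivity, fun r t hr ht => ?_⟩
  obtain ⟨h1, h2⟩ := hC r t hr ht
  have h3 := hquad 0 (u r t) (by simpa using hC0) h1 h0.1
  rw [hV0, sub_zero, sub_zero] at h3
  have h4 : wV V * V (u r t) ≤ wV V * (B * ‖u r t‖ ^ 2) := by
    gcongr; exact (le_abs_self _).trans h3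
  have h5 : fireDensity V u r t ≤ (wV V + wV V * B + 1) * (‖u r t‖ ^ 2 + ‖ur u r t‖ ^ 2) := by
    unfold fireDensity
    have e1 : 0 ≤ wV V * ‖ur u r t‖ ^ 2 := by positivity
    have e2 : 0 ≤ wV V * B * ‖ur u r t‖ ^ 2 := by positivity
    have e3 : 0 ≤ wV V * ‖u r t‖ ^ 2 := by positivity
    have e4 : 0 ≤ ‖ur u r t‖ ^ 2 := by positivity
    have e5 : 0 ≤ ‖u r t‖ ^ 2 := by positivity
    linarith
  exact ⟨h5, h5.trans (by gcongr)⟩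

lemma IsRadialSolution.integrableOn_firewall {d : ℕ} (hd : 2 ≤ d) {l : ℝ} (hl : 0 < l)
    {V : Euc n → ℝ} (hV : ContDiff ℝ 2 V) (hc : HCoerc V)
    (h0 : (0 : Euc n) ∈ MinSet V) (hV0 : V 0 = 0)
    {u : ℝ → ℝ → Euc n} (hu : IsRadialSolution d V u) (ρ : ℝ) {t : ℝ} (ht : 0 < t) :
    IntegrableOn (fun r => Tpsi d l ρ r * fireDensity V u r t) (Ioi 0) := by
  obtain ⟨B, M, hB, hM, hBM⟩ := hu.exists_fireDensity_le hV h0 hV0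
  have hint := (integral_exp_neg_abs (kappa0_pos hl) ρ).1
  refine Integrable.mono' (hint.mul_const M).integrableOn ?_ ?_
  · exact ((measurable_Tpsi d l ρ).mul
      (hu.continuous_fireDensity hV ht).measurable).aestronglyMeasurable
  · refine ae_restrict_of_forall_mem measurableSet_Ioi fun r hr => ?_
    have hr' : 0 ≤ r := (mem_Ioi.1 hr).le
    have h1 := fireDensity_nonneg hV hc h0 hV0 u r t
    rw [Real.norm_eq_abs, abs_of_nonneg (mul_nonneg (Tpsi_nonneg hd l ρ hr') h1)]
    exact mul_le_mul (Tpsi_le hd l ρ hr') (hBM r t hr' ht).2 h1 (Real.exp_pos _).le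

lemma F0_nonneg {d : ℕ} (hd : 2 ≤ d) (l : ℝ)
    {V : Euc n → ℝ} (hV : ContDiff ℝ 2 V) (hc : HCoerc V)
    (h0 : (0 : Euc n) ∈ MinSet V) (hV0 : V 0 = 0) (u : ℝ → ℝ → Euc n) (ρ t : ℝ) :
    0 ≤ F0 V d l u ρ t := by
  rw [F0_eq]
  exact setIntegral_nonneg measurableSet_Ioi fun r hr =>
    mul_nonneg (Tpsi_nonneg hd l ρ (mem_Ioi.1 hr).le) (fireDensity_nonneg hV hc h0 hV0 u r t)

lemma IsRadialSolution.norm_sq_le_F0 {d : ℕ} (hd : 2 ≤ d) {l : ℝ} (hl : 0 < l)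
    {V : Euc n → ℝ} (hV : ContDiff ℝ 2 V) (hc : HCoerc V)
    (h0 : (0 : Euc n) ∈ MinSet V) (hV0 : V 0 = 0)
    {u : ℝ → ℝ → Euc n} (hu : IsRadialSolution d V u) {ρ : ℝ} (hρ : rsc d l ≤ ρ)
    {t : ℝ} (ht : 0 < t) :
    min (wV V / 2) (1 / 4) * ‖u ρ t‖ ^ 2 ≤ (kappa0 l + 1) * F0 V d l u ρ t := by
  have hκ := kappa0_pos hl
  set κ := kappa0 l with hκdef
  set μ := min (wV V / 2) (1 / 4) with hμ
  have hρ0 : 0 < ρ := (rsc_pos hd l).trans_le hρ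
  obtain ⟨C, hC0, hC⟩ := hu.exists_bound
  set g' : ℝ → ℝ := fun x => Real.exp (-κ * (x - ρ)) * (-κ) * ‖u x t‖ ^ 2 +
    Real.exp (-κ * (x - ρ)) * (2 * inner ℝ (u x t) (ur u x t)) with hg'
  have hder : ∀ x, HasDerivAt (fun x => Real.exp (-κ * (x - ρ)) * ‖u x t‖ ^ 2) (g' x) x := by
    intro x
    have h1 : HasDerivAt (fun x => Real.exp (-κ * (x - ρ))) (Real.exp (-κ * (x - ρ)) * (-κ)) x := by
      have := (((hasDerivAt_id x).sub_const ρ).const_mul (-κ)).exp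
      simpa using this
    exact h1.mul (hu.diff_r t ht x).hasDerivAt.norm_sq
  have hexp : ∀ x ∈ Ioi ρ, Real.exp (-κ * (x - ρ)) = Real.exp (-κ * |x - ρ|) := by
    intro x hx
    rw [abs_of_pos (sub_pos.2 hx)]
  have hbase := (setIntegral_exp_neg_abs_Ioi hκ (le_refl ρ)).1
  have hg'bound : ∀ x, |g' x| ≤
      Real.exp (-κ * (x - ρ)) * ((κ + 1) * (‖u x t‖ ^ 2 + ‖ur u x t‖ ^ 2)) := by
    intro x
    have h1 := abs_real_inner_le_norm (u x t) (ur u x t)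
    have h2 : g' x = Real.exp (-κ * (x - ρ)) *
        (-κ * ‖u x t‖ ^ 2 + 2 * inner ℝ (u x t) (ur u x t)) := by
      simp only [hg']; ring
    rw [h2, abs_mul, abs_of_pos (Real.exp_pos _)]
    refine mul_le_mul_of_nonneg_left ?_ (Real.exp_pos _).le
    have h3 := two_mul_le_add_sq ‖u x t‖ ‖ur u x t‖
    obtain ⟨h4, h5⟩ := abs_le.1 h1
    have h6 : 0 ≤ κ * ‖ur u x t‖ ^ 2 := by positivity
    have h7 : 0 ≤ κ * ‖u x t‖ ^ 2 := by positivity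
    rw [abs_le]; constructor <;> nlinarith
  have hg'cont : Continuous g' := by
    have h1 := hu.continuous_u ht
    have h2 := hu.continuous_ur ht
    simp only [hg']; fun_prop
  have hg'int : IntegrableOn g' (Ioi ρ) := by
    refine Integrable.mono' (hbase.mul_const ((κ + 1) * (C ^ 2 + C ^ 2)))
      hg'cont.aestronglyMeasurable (ae_restrict_of_forall_mem measurableSet_Ioi fun x hx => ?_)
    obtain ⟨h1, h2⟩ := hC x t (hρ0.le.trans (mem_Ioi.1 hx).le) ht
    refine (hg'bound x).trans ?_
    rw [hexp x hx]
    gcongr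
  have hlim : Tendsto (fun x => Real.exp (-κ * (x - ρ)) * ‖u x t‖ ^ 2) atTop (𝓝 0) := by
    have hlin : Tendsto (fun x : ℝ => -κ * (x - ρ)) atTop atBot :=
      (tendsto_atTop_add_const_right atTop (-ρ) tendsto_id).const_mul_atTop_of_neg
        (neg_lt_zero.2 hκ)
    have h2 : Tendsto (fun x => Real.exp (-κ * (x - ρ)) * C ^ 2) atTop (𝓝 0) := by
      simpa using (Real.tendsto_exp_atBot.comp hlin).mul_const (C ^ 2)
    refine tendsto_of_tendsto_of_tendsto_of_le_of_le' tendsto_const_nhds h2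
      (Eventually.of_forall fun x => by positivity) ?_
    filter_upwards [eventually_ge_atTop 0] with x hx
    have := (hC x t hx ht).1
    gcongr
  have hFTC := integral_Ioi_of_hasDerivAt_of_tendsto
    (hder ρ).continuousAt.continuousWithinAt (fun x _ => hder x) hg'int hlim
  simp only [sub_self, mul_zero, Real.exp_zero, one_mul, zero_sub] at hFTC
  have hint := hu.integrableOn_firewall hd hl hV hc h0 hV0 ρ ht
  have hnn : ∀ x ∈ Ioi (0 : ℝ), 0 ≤ Tpsi d l ρ x * fireDensity V u x t := fun x hx =>
    mul_nonneg (Tpsi_nonneg hd l ρ (mem_Ioi.1 hx).le) (fireDensity_nonneg hV hc h0 hV0 u x t)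
  have hμ0 : 0 < μ := by have := wV_pos V; positivity
  have hstep : ∫ x in Ioi ρ, μ * (-g' x) ≤
      ∫ x in Ioi ρ, (κ + 1) * (Tpsi d l ρ x * fireDensity V u x t) := by
    refine setIntegral_mono_on (hg'int.neg.const_mul μ)
      ((hint.mono_set (Ioi_subset_Ioi hρ0.le)).const_mul _) measurableSet_Ioi fun x hx => ?_
    rw [Tpsi_of_lt ρ (hρ.trans_lt (mem_Ioi.1 hx)), ← hκdef, ← hexp x hx]
    have h1 := (neg_le_abs (g' x)).trans (hg'bound x)
    have h2 := fireDensity_ge hV hc h0 hV0 u x t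
    calc μ * (-g' x)
        ≤ μ * (Real.exp (-κ * (x - ρ)) * ((κ + 1) * (‖u x t‖ ^ 2 + ‖ur u x t‖ ^ 2))) := by
          gcongr
      _ = (κ + 1) * (Real.exp (-κ * (x - ρ)) * (μ * (‖u x t‖ ^ 2 + ‖ur u x t‖ ^ 2))) := by ring
      _ ≤ _ := by gcongr
  rw [integral_const_mul, integral_neg, hFTC, neg_neg, integral_const_mul] at hstep
  refine hstep.trans (mul_le_mul_of_nonneg_left ?_ (by positivity))
  rw [F0_eq]
  exact setIntegral_mono_set hint (ae_restrict_of_forall_mem measurableSet_Ioi hnn)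
    (LE.le.eventuallyLE (Ioi_subset_Ioi hρ0.le))

lemma IsRadialSolution.exists_F0_le_near_rHom {d : ℕ} (hd : 2 ≤ d) {l : ℝ} (hl : 0 < l)
    {V : Euc n → ℝ} (hV : ContDiff ℝ 2 V) (hc : HCoerc V)
    (h0 : (0 : Euc n) ∈ MinSet V) (hV0 : V 0 = 0)
    {u : ℝ → ℝ → Euc n} (hu : IsRadialSolution d V u) {cHom : ℝ} {rHom : ℝ → ℝ}
    (hhom : HHomWith u 0 cHom rHom) (L : ℝ) {η : ℝ} (hη : 0 < η) :
    ∃ T : ℝ, 1 ≤ T ∧ ∀ t ≥ T, ∀ ρ, rHom t - L ≤ ρ → ρ ≤ rHom t → F0 V d l u ρ t ≤ η := by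
  have hκ := kappa0_pos hl
  set κ := kappa0 l with hκdef
  have hκ2 : 0 < κ / 2 := by positivity
  obtain ⟨B, M, hB, hM, hBM⟩ := hu.exists_fireDensity_le hV h0 hV0
  obtain ⟨L', hL'0, hL'⟩ : ∃ L' : ℝ, 0 < L' ∧
      M * Real.exp (-(κ / 2) * (L' - L)) * (2 * (κ / 2)⁻¹) ≤ η / 2 := by
    have hlin : Tendsto (fun x : ℝ => -(κ / 2) * (x - L)) atTop atBot :=
      (tendsto_atTop_add_const_right atTop (-L) tendsto_id).const_mul_atTop_of_neg
        (neg_lt_zero.2 hκ2)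
    have h2 : Tendsto (fun x => M * Real.exp (-(κ / 2) * (x - L)) * (2 * (κ / 2)⁻¹))
        atTop (𝓝 0) := by
      simpa using ((Real.tendsto_exp_atBot.comp hlin).const_mul M).mul_const (2 * (κ / 2)⁻¹)
    obtain ⟨x, hx, hx'⟩ :=
      ((h2.eventually (eventually_le_nhds (half_pos hη))).and (eventually_gt_atTop 0)).exists
    exact ⟨x, hx', hx⟩
  have hlim := (hhom.2.2.2 L' hL'0).const_mul B
  rw [mul_zero] at hlim
  obtain ⟨T, hT⟩ := eventually_atTop.1 (hlim.eventually (eventually_le_nhds (half_pos hη)))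
  refine ⟨max T 1, le_max_right _ _, fun t ht ρ hρ1 hρ2 => ?_⟩
  have ht0 : 0 < t := one_pos.trans_le ((le_max_right _ _).trans ht)
  have hT' := hT t ((le_max_left _ _).trans ht)
  simp only [sub_zero] at hT'
  rw [intervalIntegral.integral_comp_add_left
    (fun x => ‖u x t‖ ^ 2 + ‖ur u x t‖ ^ 2) (rHom t),
    intervalIntegral.integral_of_le (by linarith)] at hT'
  set S := Ioc (rHom t + -L') (rHom t + L') with hS
  set E : ℝ → ℝ := fun x => ‖u x t‖ ^ 2 + ‖ur u x t‖ ^ 2 with hE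
  have hEcont : Continuous E := by
    have h1 := hu.continuous_u ht0
    have h2 := hu.continuous_ur ht0
    simp only [hE]; fun_prop
  have hE0 : ∀ x, 0 ≤ E x := fun x => by simp only [hE]; positivity
  obtain ⟨hexpint, hexpval⟩ := integral_exp_neg_abs hκ2 ρ
  have hSint : Integrable (S.indicator E) :=
    (integrable_indicator_iff measurableSet_Ioc).2
      (hEcont.integrableOn_Icc.mono_set Ioc_subset_Icc_self)
  set g : ℝ → ℝ := fun x => B * S.indicator E x +
    M * Real.exp (-(κ / 2) * (L' - L)) * Real.exp (-(κ / 2) * |x - ρ|) with hg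
  have hgint : Integrable g := (hSint.const_mul B).add (hexpint.const_mul _)
  have hind0 : ∀ x, 0 ≤ S.indicator E x := fun x => indicator_nonneg (fun y _ => hE0 y) x
  have hg0 : ∀ x, 0 ≤ g x := fun x => by
    have := hind0 x
    simp only [hg]; positivity
  have hpt : ∀ x ∈ Ioi (0 : ℝ), Tpsi d l ρ x * fireDensity V u x t ≤ g x := by
    intro x hx
    have hx0 : 0 ≤ x := (mem_Ioi.1 hx).le
    have hfd := fireDensity_nonneg hV hc h0 hV0 u x t
    have hT1 := Tpsi_le hd l ρ hx0
    obtain ⟨hb1, hb2⟩ := hBM x t hx0 ht0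
    by_cases hxS : x ∈ S
    · simp only [hg, indicator_of_mem hxS]
      have h1 : Tpsi d l ρ x ≤ 1 := hT1.trans (Real.exp_le_one_iff.2 (by
        have := abs_nonneg (x - ρ); rw [← hκdef]; nlinarith))
      have h2 : Tpsi d l ρ x * fireDensity V u x t ≤ 1 * (B * E x) := by
        gcongr
      have h3 : 0 ≤ M * Real.exp (-(κ / 2) * (L' - L)) * Real.exp (-(κ / 2) * |x - ρ|) := by
        positivity
      linarith
    · simp only [hg, indicator_of_notMem hxS, mul_zero, zero_add]
      have hdist : L' - L ≤ |x - ρ| := by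
        rw [hS, mem_Ioc, not_and_or, not_lt, not_le] at hxS
        rcases hxS with h | h
        · have := neg_abs_le (x - ρ); linarith
        · have := le_abs_self (x - ρ); linarith
      calc Tpsi d l ρ x * fireDensity V u x t
          ≤ Real.exp (-κ * |x - ρ|) * M := by gcongr
        _ = M * Real.exp (-(κ / 2) * |x - ρ|) * Real.exp (-(κ / 2) * |x - ρ|) := by
          rw [mul_assoc, ← Real.exp_add, mul_comm]; congr 2; ring
        _ ≤ _ := by
          refine mul_le_mul_of_nonneg_right (mul_le_mul_of_nonneg_left
            (Real.exp_le_exp.2 ?_) hM) (Real.exp_pos _).le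
          nlinarith
  calc F0 V d l u ρ t ≤ ∫ x in Ioi (0 : ℝ), g x :=
        setIntegral_mono_on (hu.integrableOn_firewall hd hl hV hc h0 hV0 ρ ht0)
          hgint.integrableOn measurableSet_Ioi hpt
    _ ≤ ∫ x, g x := setIntegral_le_integral hgint (Eventually.of_forall hg0)
    _ = (B * ∫ x in S, E x) + M * Real.exp (-(κ / 2) * (L' - L)) * (2 * (κ / 2)⁻¹) := by
        simp only [hg]
        rw [integral_add (hSint.const_mul B) (hexpint.const_mul _), integral_const_mul,
          integral_const_mul, hexpval, integral_indicator measurableSet_Ioc]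
    _ ≤ η := by linarith

lemma hull_ge (δ : ℝ) {L : ℝ} (hL : 0 < L) (x : ℝ) :
    ((δ ^ 2 / 4 : ℝ) : EReal) ≤ hull δ L x := by
  unfold hull
  split_ifs with h1 h2
  · exact le_top
  · rw [EReal.coe_le_coe_iff]
    have : x / (2 * L) ≤ 1 / 2 := by rw [div_le_div_iff₀ (by positivity) two_pos]; linarith
    nlinarith [sq_nonneg δ]
  · exact le_rfl

lemma hull_le (δ : ℝ) {L : ℝ} (hL : 0 < L) {x : ℝ} (hx : 0 ≤ x) :
    hull δ L x ≤ ((δ ^ 2 / 2 : ℝ) : EReal) := by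
  unfold hull
  rw [if_neg (not_lt.2 hx)]
  split_ifs with h2
  · rw [EReal.coe_le_coe_iff]
    have : 0 ≤ x / (2 * L) := by positivity
    nlinarith [sq_nonneg δ]
  · rw [EReal.coe_le_coe_iff]; nlinarith [sq_nonneg δ]

lemma hull_eq_of_le (δ : ℝ) {L : ℝ} (hL : 0 < L) {x : ℝ} (hx : L ≤ x) :
    hull δ L x = ((δ ^ 2 / 4 : ℝ) : EReal) := by
  unfold hull
  rw [if_neg (not_lt.2 (hL.le.trans hx))]
  split_ifs with h2
  · have : x = L := le_antisymm h2 hx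
    subst this
    congr 1; field_simp; norm_num
  · rfl

lemma hull_of_neg (δ L : ℝ) {x : ℝ} (hx : x < 0) : hull δ L x = ⊤ := if_pos hx

lemma setIntegral_Sigma0_Tpsi_le {d : ℕ} (hd : 2 ≤ d) {l : ℝ} (hl : 0 < l) {V : Euc n → ℝ}
    {u : ℝ → ℝ → Euc n} (hu : IsRadialSolution d V u) (dEsc : ℝ) {t : ℝ} (ht : 0 < t)
    {a r b : ℝ} (har : a ≤ r) (hrb : r ≤ b) (hab : ∀ x ∈ Ioc a b, ‖u x t‖ ≤ dEsc) :
    ∫ x in Sigma0 u dEsc t, Tpsi d l r x ≤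
      (kappa0 l)⁻¹ * (Real.exp (-(kappa0 l) * (r - a)) + Real.exp (-(kappa0 l) * (b - r))) := by
  obtain ⟨h1, h1'⟩ := setIntegral_exp_neg_abs_Iic (kappa0_pos hl) har
  obtain ⟨h2, h2'⟩ := setIntegral_exp_neg_abs_Ioi (kappa0_pos hl) hrb
  have hmeas : MeasurableSet (Sigma0 u dEsc t) :=
    measurableSet_Ici.inter (measurableSet_lt measurable_const (hu.continuous_u ht).norm.measurable)
  have hsub : Sigma0 u dEsc t ⊆ Iic a ∪ Ioi b := by
    intro x hx
    by_contra hcon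
    simp only [mem_union, mem_Iic, mem_Ioi, not_or, not_le, not_lt] at hcon
    exact absurd (hab x hcon) (not_le.2 hx.2)
  have hU := h1.union h2
  calc ∫ x in Sigma0 u dEsc t, Tpsi d l r x
      ≤ ∫ x in Sigma0 u dEsc t, Real.exp (-(kappa0 l) * |x - r|) := by
        refine integral_mono_of_nonneg
          (ae_restrict_of_forall_mem hmeas fun x hx => Tpsi_nonneg hd l r hx.1)
          (hU.mono_set hsub) (ae_restrict_of_forall_mem hmeas fun x hx => Tpsi_le hd l r hx.1)
    _ ≤ ∫ x in Iic a ∪ Ioi b, Real.exp (-(kappa0 l) * |x - r|) :=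
        setIntegral_mono_set hU (Eventually.of_forall fun x => (Real.exp_pos _).le)
          (LE.le.eventuallyLE hsub)
    _ = _ := by
        rw [setIntegral_union (Iic_disjoint_Ioi (har.trans hrb)) measurableSet_Ioi h1 h2, h1', h2']
        ring

lemma le_two_mul_of_deriv_le {y : ℝ → ℝ} {ν a t₀ t₁ : ℝ} (hν : 0 < ν) (ha : 0 ≤ a)
    (hdiff : ∀ t ∈ Icc t₀ t₁, DifferentiableAt ℝ y t)
    (hder : ∀ t ∈ Icc t₀ t₁, deriv y t ≤ -ν * y t + ν * a) (h0 : y t₀ ≤ 2 * a)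
    {t : ℝ} (ht : t ∈ Icc t₀ t₁) : y t ≤ 2 * a := by
  have hd : ∀ t ∈ Icc t₀ t₁, HasDerivAt (fun t => Real.exp (ν * t) * (y t - a))
      (Real.exp (ν * t) * ν * (y t - a) + Real.exp (ν * t) * deriv y t) t := by
    intro t ht
    have h1 : HasDerivAt (fun t => Real.exp (ν * t)) (Real.exp (ν * t) * ν) t := by
      simpa using ((hasDerivAt_id t).const_mul ν).exp
    exact h1.mul ((hdiff t ht).hasDerivAt.sub_const a)
  have hanti : AntitoneOn (fun t => Real.exp (ν * t) * (y t - a)) (Icc t₀ t₁) := by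
    refine antitoneOn_of_deriv_nonpos (convex_Icc _ _)
      (fun t ht => (hd t ht).continuousAt.continuousWithinAt)
      (fun t ht => (hd t (interior_subset ht)).differentiableAt.differentiableWithinAt)
      (fun t ht => ?_)
    rw [(hd t (interior_subset ht)).deriv]
    have := hder t (interior_subset ht)
    have h2 := Real.exp_pos (ν * t)
    nlinarith
  have h1 := hanti (left_mem_Icc.2 (ht.1.trans ht.2)) ht ht.1
  simp only at h1
  have h2 : Real.exp (ν * t₀) * (y t₀ - a) ≤ Real.exp (ν * t) * a := by
    have h3 : Real.exp (ν * t₀) ≤ Real.exp (ν * t) :=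
      Real.exp_le_exp.2 (mul_le_mul_of_nonneg_left ht.1 hν.le)
    calc _ ≤ Real.exp (ν * t₀) * a := by gcongr; linarith
      _ ≤ _ := by gcongr
  have h4 := le_of_mul_le_mul_left (h1.trans h2) (Real.exp_pos _)
  linarith

lemma rescSet_nonempty {V : Euc n → ℝ} {d : ℕ} {l : ℝ} {u : ℝ → ℝ → Euc n} {δ L₀ : ℝ}
    {rHom : ℝ → ℝ} (hhull : HullBound V d l u δ L₀ rHom) {t : ℝ} (ht : 0 ≤ t) :
    (rescSet V d l u δ L₀ rHom t).Nonempty :=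
  ⟨rHom t - 1, ⟨(hhull t ht).1, by linarith⟩, (hhull t ht).2⟩

lemma rescSet_bddBelow (V : Euc n → ℝ) (d : ℕ) (l : ℝ) (u : ℝ → ℝ → Euc n) (δ L₀ : ℝ)
    (rHom : ℝ → ℝ) (t : ℝ) : BddBelow (rescSet V d l u δ L₀ rHom t) :=
  ⟨rsc d l, fun _ hx => hx.1.1⟩

lemma rsc_le_rescF {V : Euc n → ℝ} {d : ℕ} {l : ℝ} {u : ℝ → ℝ → Euc n} {δ L₀ : ℝ}
    {rHom : ℝ → ℝ} (hhull : HullBound V d l u δ L₀ rHom) {t : ℝ} (ht : 0 ≤ t) :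
    rsc d l ≤ rescF V d l u δ L₀ rHom t :=
  le_csInf (rescSet_nonempty hhull ht) fun _ hx => hx.1.1

lemma rescF_le_rHom {V : Euc n → ℝ} {d : ℕ} {l : ℝ} {u : ℝ → ℝ → Euc n} {δ L₀ : ℝ}
    {rHom : ℝ → ℝ} (hhull : HullBound V d l u δ L₀ rHom) {t : ℝ} (ht : 0 ≤ t) :
    rescF V d l u δ L₀ rHom t ≤ rHom t := by
  obtain ⟨x, hx⟩ := rescSet_nonempty hhull ht
  exact (csInf_le (rescSet_bddBelow V d l u δ L₀ rHom t) hx).trans hx.1.2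

lemma F0_sub_le {V : Euc n → ℝ} (hV : ContDiff ℝ 2 V) (hc : HCoerc V)
    (h0 : (0 : Euc n) ∈ MinSet V) (hV0 : V 0 = 0) {d : ℕ} (hd : 2 ≤ d) {l : ℝ} (hl : 0 < l)
    {u : ℝ → ℝ → Euc n} (hu : IsRadialSolution d V u) {dEsc ν K : ℝ} (hν : 0 < ν) (hK : 0 < K)
    (hfire : FireIneq V d l dEsc u ν K) {r : ℝ} (hr : rsc d l ≤ r) {t₀ t : ℝ} (ht₀ : 0 < t₀)
    (ht : t₀ ≤ t) :
    F0 V d l u r t - F0 V d l u r t₀ ≤ K * ((kappa0 l)⁻¹ * 2) * (t - t₀) := by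
  have hdiff : ∀ x ∈ Icc t₀ t, DifferentiableAt ℝ (fun s => F0 V d l u r s) x := fun x hx =>
    (hfire r hr x (ht₀.trans_le hx.1)).1
  refine (convex_Icc t₀ t).image_sub_le_mul_sub_of_deriv_le
    (fun x hx => (hdiff x hx).continuousAt.continuousWithinAt)
    (fun x hx => (hdiff x (interior_subset hx)).differentiableWithinAt) (fun x hx => ?_)
    t₀ (left_mem_Icc.2 ht) t (right_mem_Icc.2 ht) ht
  have hx0 : 0 < x := ht₀.trans_le (interior_subset hx).1
  refine (hfire r hr x hx0).2.trans ?_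
  have h1 := setIntegral_Sigma0_Tpsi_le hd hl hu dEsc hx0 (le_refl r) (le_refl r)
    (fun y hy => absurd hy (by simp))
  simp only [sub_self, mul_zero, Real.exp_zero, one_add_one_eq_two] at h1
  have h2 := mul_le_mul_of_nonneg_left h1 hK.le
  have h3 := mul_nonneg hν.le (F0_nonneg hd l hV hc h0 hV0 u r x)
  linarith

/-- The escape point moves to the right by at most `L₀` during a uniform lapse of time,
for every large enough starting time. -/
lemma exists_rescF_add_le {d : ℕ} (hd : 2 ≤ d)
    {V : Euc n → ℝ} (hV : ContDiff ℝ 2 V) (hc : HCoerc V)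
    (D : EscData n V) (h0 : (0 : Euc n) ∈ MinSet V) (hV0 : V 0 = 0)
    {u : ℝ → ℝ → Euc n} (hu : IsRadialSolution d V u)
    {cHom : ℝ} {rHom : ℝ → ℝ} (hhom : HHomWith u 0 cHom rHom)
    {ν K δ L₀ : ℝ} (hν : 0 < ν) (hK : 0 < K)
    (hδ : δ = deltaEsc D.dEsc (wV V) (kappa0 D.lmin))
    (hL : L₀ = L0c (kappa0 D.lmin) ν K δ) (hL0 : 0 < L₀)
    (hfire : FireIneq V d D.lmin D.dEsc u ν K)
    (hhull : HullBound V d D.lmin u δ L₀ rHom) :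
    ∃ T s₁ : ℝ, 0 ≤ T ∧ 0 < s₁ ∧ ∀ t ≥ T, ∀ s, 0 ≤ s → s ≤ s₁ →
      rescF V d D.lmin u δ L₀ rHom (t + s) ≤ rescF V d D.lmin u δ L₀ rHom t + L₀ := by
  have hl := D.lmin_pos
  have hκ := kappa0_pos hl
  have hμ0 : 0 < min (wV V / 2) (1 / 4) := by have := wV_pos V; positivity
  have hδ2 : (kappa0 D.lmin + 1) * δ ^ 2 = D.dEsc ^ 2 * min (wV V / 2) (1 / 4) := by
    rw [hδ, deltaEsc, mul_pow, Real.sq_sqrt (by positivity)]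
    field_simp
  have hδpos : 0 < δ ^ 2 := by
    have h1 : 0 < (kappa0 D.lmin + 1) * δ ^ 2 := by
      have := D.dEsc_pos
      rw [hδ2]; positivity
    exact pos_of_mul_pos_right h1 (by positivity)
  have hexpL : Real.exp (-(kappa0 D.lmin) * L₀) = ν * δ ^ 2 * kappa0 D.lmin / (16 * K) := by
    have : -(kappa0 D.lmin) * L₀ = -Real.log (16 * K / (ν * δ ^ 2 * kappa0 D.lmin)) := by
      rw [hL, L0c]; field_simp
    rw [this, Real.exp_neg, Real.exp_log (by positivity), inv_div]
  have hsmall : ∀ r t : ℝ, rsc d D.lmin ≤ r → 0 < t → F0 V d D.lmin u r t ≤ δ ^ 2 →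
      ‖u r t‖ ≤ D.dEsc := by
    intro r t hr ht hF
    have h1 := hu.norm_sq_le_F0 hd hl hV hc h0 hV0 hr ht
    have h2 : min (wV V / 2) (1 / 4) * ‖u r t‖ ^ 2 ≤
        min (wV V / 2) (1 / 4) * D.dEsc ^ 2 := by
      refine h1.trans ?_
      rw [mul_comm _ (D.dEsc ^ 2), ← hδ2]
      gcongr
    exact le_of_sq_le_sq (le_of_mul_le_mul_left h2 hμ0) D.dEsc_pos.le
  set s₁ := δ ^ 2 * kappa0 D.lmin / (4 * K) with hs₁
  have hs₁pos : 0 < s₁ := by positivity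
  have hcHom := hhom.1
  obtain ⟨T₁, hT₁1, hT₁⟩ := hu.exists_F0_le_near_rHom hd hl hV hc h0 hV0 hhom
    (L₀ + (cHom + 1) * s₁) (show 0 < δ ^ 2 / 4 by positivity)
  obtain ⟨T₂, hT₂⟩ := eventually_atTop.1
    (hhom.2.2.1.eventually (eventually_le_nhds (lt_add_one cHom)))
  refine ⟨max T₁ T₂, s₁, by linarith [le_max_left T₁ T₂], hs₁pos, fun t ht s hs0 hs1 => ?_⟩
  have htT₁ : T₁ ≤ t := (le_max_left _ _).trans ht
  have htT₂ : T₂ ≤ t := (le_max_right _ _).trans ht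
  have ht0 : 0 < t := by linarith
  have hrHomstep : rHom (t + s) ≤ rHom t + (cHom + 1) * s₁ := by
    have h1 := (convex_Icc t (t + s)).image_sub_le_mul_sub_of_deriv_le (f := rHom)
      (C := cHom + 1)
      (fun x _ => (hhom.2.1 x).continuousAt.continuousWithinAt)
      (fun x _ => (hhom.2.1 x).differentiableWithinAt)
      (fun x hx => hT₂ x (htT₂.trans (interior_subset hx).1))
      t (left_mem_Icc.2 (by linarith)) (t + s) (right_mem_Icc.2 (by linarith)) (by linarith)
    have h2 : (cHom + 1) * s ≤ (cHom + 1) * s₁ := by gcongr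
    rw [add_sub_cancel_left] at h1
    linarith
  rw [← sub_le_iff_le_add]
  refine le_csInf (rescSet_nonempty hhull ht0.le) fun rl hrl => ?_
  rw [sub_le_iff_le_add]
  rcases lt_or_ge (rHom (t + s)) (rl + L₀) with hlt | hge
  · exact (rescF_le_rHom hhull (by linarith)).trans hlt.le
  refine csInf_le (rescSet_bddBelow _ _ _ _ _ _ _ _)
    ⟨⟨by linarith [hrl.1.1], hge⟩, fun r hr => ?_⟩
  rcases lt_or_ge r (rl + L₀) with h | h1
  · rw [hull_of_neg δ L₀ (show r - (rl + L₀) < 0 by linarith)]; simp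
  rcases lt_or_ge (rHom (t + s)) r with h | h2
  · rw [hull_of_neg δ L₀ (show rHom (t + s) - r < 0 by linarith)]; simp
  refine le_trans ?_ ((hull_ge δ hL0 (r - (rl + L₀))).trans (le_max_left _ _))
  rw [EReal.coe_le_coe_iff]
  rcases le_or_gt (rHom (t + s) - (L₀ + (cHom + 1) * s₁)) r with h3 | h3
  · exact hT₁ (t + s) (by linarith) r h3 h2
  have hrR : r ≤ rHom t - L₀ := by linarith
  have hcalm : ∀ τ ∈ Icc t (t + s), ∀ x ∈ Ioc rl (rHom t), ‖u x τ‖ ≤ D.dEsc := by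
    intro τ hτ x hx
    have hxsc : rsc d D.lmin ≤ x := hrl.1.1.trans hx.1.le
    refine hsmall x τ hxsc (ht0.trans_le hτ.1) ?_
    have h4 : F0 V d D.lmin u x t ≤ δ ^ 2 / 2 := by
      rw [← EReal.coe_le_coe_iff]
      exact (hrl.2 x hxsc).trans (max_le (hull_le δ hL0 (by linarith [hx.1]))
        (hull_le δ hL0 (by linarith [hx.2])))
    have h5 := F0_sub_le hV hc h0 hV0 hd hl hu hν hK hfire hxsc ht0 hτ.1
    have h6 : K * ((kappa0 D.lmin)⁻¹ * 2) * (τ - t) ≤ K * ((kappa0 D.lmin)⁻¹ * 2) * s₁ := by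
      gcongr; linarith [hτ.2]
    have h7 : K * ((kappa0 D.lmin)⁻¹ * 2) * s₁ = δ ^ 2 / 2 := by
      rw [hs₁]; field_simp; ring
    linarith
  have hinit : F0 V d D.lmin u r t ≤ 2 * (δ ^ 2 / 8) := by
    have h4 := hrl.2 r hr
    rw [hull_eq_of_le δ hL0 (by linarith), hull_eq_of_le δ hL0 (by linarith), max_self,
      EReal.coe_le_coe_iff] at h4
    linarith
  have hfinal := le_two_mul_of_deriv_le (y := fun τ => F0 V d D.lmin u r τ) (t₁ := t + s) hν
    (show 0 ≤ δ ^ 2 / 8 by positivity)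
    (fun τ hτ => (hfire r hr τ (ht0.trans_le hτ.1)).1) (fun τ hτ => ?_) hinit
    (right_mem_Icc.2 (by linarith))
  · exact hfinal.trans (by linarith)
  · refine (hfire r hr τ (ht0.trans_le hτ.1)).2.trans ?_
    have h4 := setIntegral_Sigma0_Tpsi_le hd hl hu D.dEsc (ht0.trans_le hτ.1)
      (show rl ≤ r by linarith) (show r ≤ rHom t by linarith) (hcalm τ hτ)
    have h5 : Real.exp (-(kappa0 D.lmin) * (r - rl)) ≤ Real.exp (-(kappa0 D.lmin) * L₀) :=
      Real.exp_le_exp.2 (by nlinarith)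
    have h6 : Real.exp (-(kappa0 D.lmin) * (rHom t - r)) ≤ Real.exp (-(kappa0 D.lmin) * L₀) :=
      Real.exp_le_exp.2 (by nlinarith)
    have h7 : K * ∫ x in Sigma0 u D.dEsc τ, Tpsi d D.lmin r x ≤
        K * ((kappa0 D.lmin)⁻¹ * (Real.exp (-(kappa0 D.lmin) * L₀) +
          Real.exp (-(kappa0 D.lmin) * L₀))) := by
      refine mul_le_mul_of_nonneg_left (h4.trans ?_) hK.le
      gcongr
    have h8 : K * ((kappa0 D.lmin)⁻¹ * (Real.exp (-(kappa0 D.lmin) * L₀) +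
          Real.exp (-(kappa0 D.lmin) * L₀))) = ν * (δ ^ 2 / 8) := by
      rw [hexpL]; field_simp; ring
    linarith

lemma le_add_mul_of_local_le {f : ℝ → ℝ} {T s₁ L : ℝ} (hs₁ : 0 < s₁) (hL : 0 ≤ L)
    (hf : ∀ t ≥ T, ∀ s, 0 ≤ s → s ≤ s₁ → f (t + s) ≤ f t + L)
    {t s : ℝ} (ht : T ≤ t) (hs : 0 ≤ s) : f (t + s) ≤ f t + L * (s / s₁ + 1) := by
  have key : ∀ N : ℕ, ∀ s, 0 ≤ s → s ≤ N * s₁ → f (t + s) ≤ f t + L * N := by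
    intro N
    induction N with
    | zero =>
      intro s h1 h2
      have : s = 0 := le_antisymm (by simpa using h2) h1
      simp [this]
    | succ N ih =>
      intro s h1 h2
      push_cast at h2 ⊢
      have hN : (0 : ℝ) ≤ N * s₁ := by positivity
      rcases le_total s (N * s₁) with h | h
      · linarith [ih s h1 h]
      · have h3 := ih (N * s₁) hN le_rfl
        have h4 := hf (t + N * s₁) (by linarith) (s - N * s₁) (by linarith) (by linarith)
        rw [show t + N * s₁ + (s - N * s₁) = t + s by ring] at h4
        linarith
  have hq : 0 ≤ s / s₁ := by positivity
  refine (key ⌈s / s₁⌉₊ s hs ((div_le_iff₀ hs₁).1 (Nat.le_ceil _))).trans ?_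
  gcongr
  exact (Nat.ceil_lt_add_one hq).le

lemma exists_sub_le_cbarF {f : ℝ → ℝ} {A C : ℝ} (hA : 0 ≤ A) (hC : 0 ≤ C)
    (hf : ∀ t s, 0 ≤ t → 0 ≤ s → f (t + s) - f t ≤ A + C * s) {ε : ℝ} (hε : 0 < ε) :
    ∃ A' : ℝ, 0 ≤ A' ∧
      ∀ t s, 0 ≤ t → 0 ≤ s → f (t + s) - f t ≤ A' + (cbarF f + ε) * s := by
  have hbdd : ∀ s, 0 ≤ s → ∀ x ∈ {x : ℝ | ∃ t ≥ (0 : ℝ), x = f (t + s) - f t}, x ≤ A + C * s := by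
    rintro s hs x ⟨t, ht, rfl⟩
    exact hf t s ht hs
  have hB : IsBoundedUnder (· ≤ ·) atTop
      (fun s => sSup {x : ℝ | ∃ t ≥ (0 : ℝ), x = f (t + s) - f t} / s) := by
    refine ⟨A + C, eventually_map.2 ?_⟩
    filter_upwards [eventually_ge_atTop 1] with s hs
    rw [div_le_iff₀ (by linarith)]
    have hne : {x : ℝ | ∃ t ≥ (0 : ℝ), x = f (t + s) - f t}.Nonempty := ⟨_, 0, le_rfl, rfl⟩
    refine (csSup_le hne (hbdd s (by linarith))).trans ?_
    nlinarith
  have hev := eventually_lt_of_limsup_lt (show cbarF f < cbarF f + ε by linarith) hB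
  obtain ⟨S, hSall⟩ := eventually_atTop.1 (hev.and (eventually_gt_atTop 0))
  have hS1 : 0 < S := (hSall S le_rfl).2
  have hS := fun s hs => (hSall s hs).1
  set b := cbarF f + ε with hb
  refine ⟨A + C * S + |b| * S, by positivity, fun t s ht hs => ?_⟩
  have hpos : 0 ≤ |b| * S := by positivity
  rcases le_total S s with h | h
  · have h1 := hS s h
    rw [div_lt_iff₀ (by linarith)] at h1
    have h2 : f (t + s) - f t ≤ sSup {x : ℝ | ∃ t ≥ (0 : ℝ), x = f (t + s) - f t} :=
      le_csSup ⟨_, hbdd s hs⟩ ⟨t, ht, rfl⟩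
    have h3 : 0 ≤ C * S := by positivity
    linarith
  · have h1 := hf t s ht hs
    have h2 : C * s ≤ C * S := by gcongr
    have h3 : -(|b| * S) ≤ b * s := by
      have h4 := neg_abs_le (b * s)
      rw [abs_mul, abs_of_nonneg hs] at h4
      have h5 : |b| * s ≤ |b| * S := by gcongr
      linarith
    linarith


/-- The displacement of the escape point grows at most linearly in the elapsed time. -/
lemma exists_rescF_sub_le {d : ℕ} (hd : 2 ≤ d)
    {V : Euc n → ℝ} (hV : ContDiff ℝ 2 V) (hc : HCoerc V)
    (D : EscData n V) (h0 : (0 : Euc n) ∈ MinSet V) (hV0 : V 0 = 0)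
    {u : ℝ → ℝ → Euc n} (hu : IsRadialSolution d V u)
    {cHom : ℝ} {rHom : ℝ → ℝ} (hhom : HHomWith u 0 cHom rHom) (hmono : Monotone rHom)
    {ν K δ L₀ : ℝ} (hν : 0 < ν) (hK : 0 < K)
    (hδ : δ = deltaEsc D.dEsc (wV V) (kappa0 D.lmin))
    (hL : L₀ = L0c (kappa0 D.lmin) ν K δ) (hL0 : 0 < L₀)
    (hfire : FireIneq V d D.lmin D.dEsc u ν K)
    (hhull : HullBound V d D.lmin u δ L₀ rHom) :
    ∃ A C : ℝ, 0 ≤ A ∧ 0 ≤ C ∧ ∀ t s, 0 ≤ t → 0 ≤ s →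
      rescF V d D.lmin u δ L₀ rHom (t + s) - rescF V d D.lmin u δ L₀ rHom t ≤ A + C * s := by
  obtain ⟨T, s₁, hT, hs₁, hstep⟩ :=
    exists_rescF_add_le hd hV hc D h0 hV0 hu hhom hν hK hδ hL hL0 hfire hhull
  have hrsc := rsc_pos hd D.lmin
  have hR : 0 < rHom T := by linarith [(hhull T hT).1]
  refine ⟨rHom T + L₀, L₀ / s₁, by positivity, by positivity, fun t s ht hs => ?_⟩
  have hft := rsc_le_rescF hhull ht
  have hC : 0 ≤ L₀ / s₁ := by positivity
  have hCs : 0 ≤ L₀ / s₁ * s := by positivity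
  rcases le_total T t with h | h
  · have h1 := le_add_mul_of_local_le hs₁ hL0.le hstep h hs
    have h2 : L₀ * (s / s₁ + 1) = L₀ / s₁ * s + L₀ := by ring
    linarith
  · rcases le_total (t + s) T with h' | h'
    · have h1 := rescF_le_rHom hhull (add_nonneg ht hs)
      have h2 := hmono h'
      linarith
    · have h1 := le_add_mul_of_local_le hs₁ hL0.le hstep le_rfl (sub_nonneg.2 h')
      rw [add_sub_cancel] at h1
      have h2 : L₀ * ((t + s - T) / s₁ + 1) = L₀ / s₁ * (t + s - T) + L₀ := by ring
      have h3 : L₀ / s₁ * (t + s - T) ≤ L₀ / s₁ * s := by gcongr; linarith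
      have h4 := rescF_le_rHom hhull hT
      linarith

lemma psiTF_nonneg {d : ℕ} (hd : 2 ≤ d) (l L cno c x r0 : ℝ) {ρ s : ℝ}
    (hρ : -r0 - c * s ≤ ρ) : 0 ≤ psiTF d l L cno c x r0 ρ s := by
  have hrsc := rsc_pos hd l
  have : 0 ≤ r0 + c * s + ρ := by linarith
  unfold psiTF
  split_ifs <;> positivity

lemma psiTF_le_back {d : ℕ} (hd : 2 ≤ d) {l L cno c x r0 : ℝ} {ρ s : ℝ}
    (hκ : 0 < kappaTF l cno) (hc : 0 < c) (hρ : -r0 - c * s ≤ ρ) :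
    psiTF d l L cno c x r0 ρ s ≤
      Real.exp (-(kappaTF l cno) * (x + ccutTF l L cno * s)) *
        Real.exp ((c + kappaTF l cno) * ρ) := by
  have hrsc := rsc_pos hd l
  rw [← Real.exp_add]
  unfold psiTF
  split_ifs with h1 h2
  · rw [← mul_one (Real.exp (-(kappaTF l cno) * _ + _))]
    have h4 : ((r0 + c * s + ρ) / rsc d l) ^ (d - 1) ≤ 1 :=
      pow_le_one₀ (div_nonneg (by linarith) hrsc.le) ((div_le_one hrsc).2 (by linarith))
    refine mul_le_mul (Real.exp_le_exp.2 (by linarith)) h4 ?_ (Real.exp_pos _).le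
    exact pow_nonneg (div_nonneg (by linarith) hrsc.le) _
  · exact Real.exp_le_exp.2 (by linarith)
  · exact Real.exp_le_exp.2 (by nlinarith)

lemma psiTF_le_front {d : ℕ} (hd : 2 ≤ d) {l L cno c x r0 : ℝ} {ρ s : ℝ}
    (hκ : 0 < kappaTF l cno) (hcc : 0 < ccutTF l L cno) (hc : 0 < c) (hx : 0 ≤ x) (hs : 0 ≤ s)
    (hr0 : 2 * rsc d l ≤ r0) (hρ : -r0 - c * s ≤ ρ) :
    psiTF d l L cno c x r0 ρ s ≤
      Real.exp ((c + kappaTF l cno) * (x + ccutTF l L cno * s)) *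
        Real.exp (-(kappaTF l cno) * ρ) := by
  have hrsc := rsc_pos hd l
  have hcut : 0 ≤ ccutTF l L cno * s := by positivity
  have hcs : 0 ≤ c * s := by positivity
  rcases le_or_gt ρ (x + ccutTF l L cno * s) with h | h
  · refine (psiTF_le_back hd hκ hc hρ).trans ?_
    rw [← Real.exp_add, ← Real.exp_add]
    exact Real.exp_le_exp.2 (by nlinarith)
  · rw [psiTF, if_neg (by linarith), if_neg h.not_ge, ← Real.exp_add]
    exact Real.exp_le_exp.2 (by linarith)

lemma setIntegral_le_of_nonneg_of_le {f g : ℝ → ℝ} {S S' : Set ℝ} (hS : MeasurableSet S)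
    (hSS' : S ⊆ S') (hg : IntegrableOn g S') (hg0 : ∀ x, 0 ≤ g x)
    (hf0 : ∀ x ∈ S, 0 ≤ f x) (hfg : ∀ x ∈ S, f x ≤ g x) :
    ∫ x in S, f x ≤ ∫ x in S', g x := by
  refine le_trans (integral_mono_of_nonneg (ae_restrict_of_forall_mem hS hf0)
    (hg.mono_set hSS') (ae_restrict_of_forall_mem hS hfg)) ?_
  exact setIntegral_mono_set hg (Eventually.of_forall hg0) hSS'.eventuallyLE

/-- Upper bound on the flux term at the back of the travelling frame. -/
lemma setIntegral_Icc_psiTF_le {d : ℕ} (hd : 2 ≤ d) {l L cno c x r0 b s : ℝ}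
    (hκ : 0 < kappaTF l cno) (hc : 0 < c) :
    ∫ ρ in Icc (-r0 - c * s) b, psiTF d l L cno c x r0 ρ s ≤
      (kappaTF l cno)⁻¹ * (Real.exp (-(kappaTF l cno) * (x + ccutTF l L cno * s)) *
        Real.exp ((c + kappaTF l cno) * b)) := by
  have hck : 0 < c + kappaTF l cno := by linarith
  refine (setIntegral_le_of_nonneg_of_le measurableSet_Icc Icc_subset_Iic_self
    ((integrableOn_exp_mul_Iic hck b).const_mul _) (fun _ => by positivity)
    (fun ρ hρ => psiTF_nonneg hd l L cno c x r0 hρ.1)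
    (fun ρ hρ => psiTF_le_back hd hκ hc hρ.1)).trans ?_
  rw [integral_const_mul, integral_exp_mul_Iic hck, div_eq_inv_mul, mul_left_comm]
  gcongr
  linarith

/-- Upper bound on the flux term at the front of the travelling frame. -/
lemma setIntegral_Ioi_psiTF_le {d : ℕ} (hd : 2 ≤ d) {l L cno c x r0 a s : ℝ}
    (hκ : 0 < kappaTF l cno) (hcc : 0 < ccutTF l L cno) (hc : 0 < c) (hx : 0 ≤ x) (hs : 0 ≤ s)
    (hr0 : 2 * rsc d l ≤ r0) (ha : -r0 - c * s ≤ a) :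
    ∫ ρ in Ioi a, psiTF d l L cno c x r0 ρ s ≤
      (kappaTF l cno)⁻¹ * (Real.exp ((c + kappaTF l cno) * (x + ccutTF l L cno * s)) *
        Real.exp (-(kappaTF l cno) * a)) := by
  have hk : -(kappaTF l cno) < 0 := by linarith
  refine (setIntegral_le_of_nonneg_of_le measurableSet_Ioi subset_rfl
    ((integrableOn_exp_mul_Ioi hk a).const_mul _) (fun _ => by positivity)
    (fun ρ hρ => psiTF_nonneg hd l L cno c x r0 (ha.trans (le_of_lt hρ)))
    (fun ρ hρ => psiTF_le_front hd hκ hcc hc hx hs hr0 (ha.trans (le_of_lt hρ)))).trans ?_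
  rw [integral_const_mul, integral_exp_mul_Ioi hk, neg_div_neg_eq, div_eq_inv_mul, mul_left_comm]

lemma EscData.lmax_pos (hn : 1 ≤ n) {V : Euc n → ℝ} (D : EscData n V)
    (h0 : (0 : Euc n) ∈ MinSet V) : 0 < D.lmax := by
  have hv : ‖(EuclideanSpace.single ⟨0, hn⟩ (1 : ℝ) : Euc n)‖ = 1 := by simp
  have h1 := D.lower 0 h0 (EuclideanSpace.single ⟨0, hn⟩ 1)
  have h2 := D.upper 0 h0 (EuclideanSpace.single ⟨0, hn⟩ 1)
  rw [hv] at h1 h2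
  linarith [D.lmin_pos]

/-- upper bounds on flux terms in the derivative of the firewall. -/
theorem stmt11 {n d k : ℕ} (hn : 1 ≤ n) (hd : 2 ≤ d) (hk : 2 ≤ k)
    (V : Euc n → ℝ) (hV : ContDiff ℝ (k : ℕ∞) V) (hcoerc : HCoerc V)
    (D : EscData n V) (h0 : (0 : Euc n) ∈ MinSet V) (hV0 : V 0 = 0)
    (u : ℝ → ℝ → Euc n) (hu : IsRadialSolution d V u)
    (cHom : ℝ) (rHom : ℝ → ℝ) (hhom : HHomWith u 0 cHom rHom)
    (hrHom' : ∀ t : ℝ, 0 ≤ deriv rHom t)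
    (ν K δ L₀ cno : ℝ) (hν : 0 < ν) (hK : 0 < K)
    (hδ : δ = deltaEsc D.dEsc (wV V) (kappa0 D.lmin))
    (hL : L₀ = L0c (kappa0 D.lmin) ν K δ)
    (hcno : cno = cNoEsc (kappa0 D.lmin) K L₀ δ)
    (hfire : FireIneq V d D.lmin D.dEsc u ν K)
    (hhull : HullBound V d D.lmin u δ L₀ rHom) :
    ∃ Ku > (0:ℝ), ∀ t0 c xcut : ℝ, 0 ≤ t0 → 0 < c → c ≤ cno → 0 ≤ xcut →
      2 * rsc d D.lmin ≤ rescF V d D.lmin u δ L₀ rHom t0 →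
      (c + kappaTF D.lmin cno) * (cbarF (rescF V d D.lmin u δ L₀ rHom) - c) ≤
        kappaTF D.lmin cno * ccutTF D.lmin D.lmax cno / 4 →
      ∀ s ≥ (0:ℝ),
        (∫ ρ in Icc (-(rescF V d D.lmin u δ L₀ rHom t0) - c * s)
            (rescF V d D.lmin u δ L₀ rHom (t0 + s) -
              rescF V d D.lmin u δ L₀ rHom t0 - c * s),
            psiTF d D.lmin D.lmax cno c xcut (rescF V d D.lmin u δ L₀ rHom t0) ρ s)
          ≤ Ku * Real.exp (-(kappaTF D.lmin cno) * xcut) *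
            Real.exp (-(kappaTF D.lmin cno * ccutTF D.lmin D.lmax cno / 2) * s) ∧
        (∫ ρ in Ioi (rHom (t0 + s) - rescF V d D.lmin u δ L₀ rHom t0 - c * s),
            psiTF d D.lmin D.lmax cno c xcut (rescF V d D.lmin u δ L₀ rHom t0) ρ s)
          ≤ (kappaTF D.lmin cno)⁻¹ * Real.exp ((cno + 1) * xcut) *
            Real.exp ((cno + kappaTF D.lmin cno) *
              (ccutTF D.lmin D.lmax cno + kappaTF D.lmin cno) * s) *
            Real.exp (-(kappaTF D.lmin cno) *
              (rHom t0 - rescF V d D.lmin u δ L₀ rHom t0)) := by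
  rcases le_or_gt cno 0 with hcno0 | hcno0
  · exact ⟨1, one_pos, fun t0 c xcut _ hc hc' => absurd (hc.trans_le hc') hcno0.not_gt⟩
  have hV2 : ContDiff ℝ 2 V :=
    hV.of_le (WithTop.coe_le_coe.2 (show (2 : ℕ∞) ≤ k from Nat.ofNat_le_cast.2 hk))
  have hl := D.lmin_pos
  have hlmax := D.lmax_pos hn h0
  have hrsc := rsc_pos hd D.lmin
  have hκ : 0 < kappaTF D.lmin cno := by unfold kappaTF; positivity
  have hκ1 : kappaTF D.lmin cno ≤ 1 / 4 := min_le_left _ _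
  have hcc : 0 < ccutTF D.lmin D.lmax cno := by unfold ccutTF; positivity
  have hmono : Monotone rHom := monotone_of_deriv_nonneg hhom.2.1 hrHom'
  have hL0 : 0 < L₀ := by
    by_contra! hneg
    have hκ0 := kappa0_pos hl
    have : cNoEsc (kappa0 D.lmin) K L₀ δ ≤ 0 :=
      div_nonpos_of_nonpos_of_nonneg (mul_nonpos_of_nonneg_of_nonpos (by positivity) hneg)
        (by positivity)
    linarith
  obtain ⟨A, C, hA, hC, hgrow⟩ := exists_rescF_sub_le hd hV2 hcoerc D h0 hV0 hu hhom hmono hν hK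
    hδ hL hL0 hfire hhull
  set f := rescF V d D.lmin u δ L₀ rHom with hf
  set κ := kappaTF D.lmin cno with hκdef
  set cc := ccutTF D.lmin D.lmax cno with hccdef
  obtain ⟨A', hA', hlin⟩ := exists_sub_le_cbarF hA hC hgrow
    (show 0 < κ * cc / (4 * (cno + κ)) by positivity)
  refine ⟨κ⁻¹ * Real.exp ((cno + κ) * A'), by positivity, ?_⟩
  intro t0 c xcut ht0 hc hcle hx hr0 hspeed s hs
  constructor
  · refine (setIntegral_Icc_psiTF_le hd hκ hc).trans ?_
    simp only [mul_assoc]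
    refine mul_le_mul_of_nonneg_left ?_ (by positivity)
    rw [← Real.exp_add, ← Real.exp_add, ← Real.exp_add]
    refine Real.exp_le_exp.2 ?_
    have h1 : f (t0 + s) - f t0 - c * s ≤ A' + (cbarF f + κ * cc / (4 * (cno + κ)) - c) * s := by
      linarith [hlin t0 s ht0 hs]
    have h2 := mul_le_mul_of_nonneg_left h1 (show 0 ≤ c + κ by positivity)
    have h3 : (c + κ) * A' ≤ (cno + κ) * A' := by gcongr
    have h4 : (c + κ) * (κ * cc / (4 * (cno + κ))) ≤ κ * cc / 4 := by
      rw [← mul_div_assoc, div_le_div_iff₀ (by positivity) (by positivity)]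
      have : (c + κ) * (κ * cc) ≤ (cno + κ) * (κ * cc) := by gcongr
      linarith
    have h5 := mul_le_mul_of_nonneg_right (add_le_add hspeed h4) hs
    linarith
  · refine (setIntegral_Ioi_psiTF_le hd hκ hcc hc hx hs hr0 ?_).trans ?_
    · linarith [(hhull (t0 + s) (by positivity)).1]
    simp only [mul_assoc]
    refine mul_le_mul_of_nonneg_left ?_ (by positivity)
    rw [← Real.exp_add, ← Real.exp_add, ← Real.exp_add]
    refine Real.exp_le_exp.2 ?_
    have h1 : κ * rHom t0 ≤ κ * rHom (t0 + s) :=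
      mul_le_mul_of_nonneg_left (hmono (by linarith)) hκ.le
    have h2 : (c + κ) * xcut ≤ (cno + 1) * xcut := by gcongr; linarith
    have h3 : (c + κ) * (cc * s) ≤ (cno + κ) * (cc * s) := by gcongr
    have h4 : c * (κ * s) ≤ (cno + κ) * (κ * s) := by gcongr; linarith
    linarith
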